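/- With K, σ₁, σ₂ and the operators D̃₁, …, D̃₆ : K → K as in the context (type G₂ Demazure-type operators), the operator identity D̃₆∘D̃₁ − D̃₁∘D̃₂ − D̃₂∘D̃₃ − D̃₃∘D̃₄ − D̃₄∘D̃₅ − D̃₅∘D̃₆ + D̃₂ + D̃₃ + D̃₄ + D̃₅ = 0 holds, i.e., for every f ∈ K, D̃₆(D̃₁(f)) − D̃₁(D̃₂(f)) − D̃₂(D̃₃(f)) − D̃₃(D̃₄(f)) − D̃₄(D̃₅(f)) − D̃₅(D̃₆(f)) + D̃₂(f) + D̃₃(f) + D̃₄(f) + D̃₅(f) = 0. (Lemma 3.3(1).) -/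

import Mathlib

noncomputable section

local notation "K" => FractionRing (MvPolynomial (Fin 2) ℤ)

noncomputable def t1 : FractionRing (MvPolynomial (Fin 2) ℤ) :=
  algebraMap (MvPolynomial (Fin 2) ℤ) _ (MvPolynomial.X 0)

noncomputable def t2 : FractionRing (MvPolynomial (Fin 2) ℤ) :=
  algebraMap (MvPolynomial (Fin 2) ℤ) _ (MvPolynomial.X 1)

theorem one_sub_t1_pow_mul_t2_pow_ne_zero (a b : ℕ) (h : a ≠ 0 ∨ b ≠ 0) :
    1 - t1 ^ a * t2 ^ b ≠ 0 := by
  intro h0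
  have h1 : (1 : MvPolynomial (Fin 2) ℤ) = MvPolynomial.X 0 ^ a * MvPolynomial.X 1 ^ b := by
    apply IsFractionRing.injective (MvPolynomial (Fin 2) ℤ) K
    simpa [t1, t2] using sub_eq_zero.mp h0
  have h2 := congrArg (MvPolynomial.eval (fun _ => (2 : ℤ))) h1
  simp only [map_one, map_mul, map_pow, MvPolynomial.eval_X, ← pow_add] at h2
  have h3 : 1 < (2 : ℤ) ^ (a + b) := one_lt_pow₀ (by norm_num) (by omega)
  omega

theorem t1_ne_zero : t1 ≠ 0 := by
  simp [t1]

theorem t2_ne_zero : t2 ≠ 0 := by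
  simp [t2]

theorem ringHom_eq_of_apply_t1_t2 {φ ψ : K →+* K} (h1 : φ t1 = ψ t1) (h2 : φ t2 = ψ t2) :
    φ = ψ := by
  apply IsLocalization.ringHom_ext (nonZeroDivisors (MvPolynomial (Fin 2) ℤ))
  apply MvPolynomial.ringHom_ext
  · intro n
    simp
  · intro i
    fin_cases i
    · exact h1
    · exact h2

theorem stmt_13 (σ1 σ2 : K ≃+* K)
    (h11 : σ1 t1 = t1⁻¹) (h12 : σ1 t2 = t1 ^ 3 * t2)
    (h21 : σ2 t1 = t1 * t2) (h22 : σ2 t2 = t2⁻¹)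
    (D1 D2 : K → K)
    (hD1 : ∀ f, D1 f = (1 - t1)⁻¹ * (f - σ1 f))
    (hD2 : ∀ f, D2 f = (1 - t2)⁻¹ * (f - σ2 f))
    (Dt1 Dt2 Dt3 Dt4 Dt5 Dt6 : K → K)
    (hDt1 : Dt1 = D1)
    (hDt2 : Dt2 = ⇑σ1 ∘ D2 ∘ ⇑σ1)
    (hDt3 : Dt3 = ⇑σ1 ∘ ⇑σ2 ∘ D1 ∘ ⇑σ2 ∘ ⇑σ1)
    (hDt4 : Dt4 = ⇑σ2 ∘ ⇑σ1 ∘ D2 ∘ ⇑σ1 ∘ ⇑σ2)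
    (hDt5 : Dt5 = ⇑σ2 ∘ D1 ∘ ⇑σ2)
    (hDt6 : Dt6 = D2) :
    ∀ f : K, Dt6 (Dt1 f) - Dt1 (Dt2 f) - Dt2 (Dt3 f) - Dt3 (Dt4 f) - Dt4 (Dt5 f) - Dt5 (Dt6 f) + Dt2 f + Dt3 f + Dt4 f + Dt5 f = 0 := by
  have ht1 := t1_ne_zero
  have ht2 := t2_ne_zero
  have sq1 (f : K) : σ1 (σ1 f) = f := by
    have h : (σ1 : K →+* K).comp (σ1 : K →+* K) = RingHom.id _ := by
      apply ringHom_eq_of_apply_t1_t2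
      · simp [h11]
      · simp [h11, h12]
        field_simp
    exact DFunLike.congr_fun h f
  have sq2 (f : K) : σ2 (σ2 f) = f := by
    have h : (σ2 : K →+* K).comp (σ2 : K →+* K) = RingHom.id _ := by
      apply ringHom_eq_of_apply_t1_t2
      · simp [h21, h22]
        field_simp
      · simp [h22]
    exact DFunLike.congr_fun h f
  have rot1 : σ1 (σ2 (σ1 (σ2 (σ1 (σ2 t1))))) = t1⁻¹ := by
    simp only [h11, h12, h21, h22, map_mul, map_pow, map_inv₀]
    field_simp
  have rot2 : σ1 (σ2 (σ1 (σ2 (σ1 (σ2 t2))))) = t2⁻¹ := by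
    simp only [h11, h12, h21, h22, map_mul, map_pow, map_inv₀]
    field_simp
  have braid (f : K) :
      σ1 (σ2 (σ1 (σ2 (σ1 (σ2 (σ1 (σ2 (σ1 (σ2 f))))))))) = σ2 (σ1 f) := by
    let τ : K →+* K := (σ1 : K →+* K).comp (σ2 : K →+* K)
    have h : (τ.comp (τ.comp τ)).comp (τ.comp (τ.comp τ)) = RingHom.id _ := by
      apply ringHom_eq_of_apply_t1_t2
      · simp [τ, rot1]
      · simp [τ, rot2]
    have h' := DFunLike.congr_fun h (σ2 (σ1 f))
    simpa [τ, sq1, sq2] using h'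
  have e1 (f : K) : Dt1 f = (1 - t1)⁻¹ * (f - σ1 f) := by
    rw [hDt1, hD1]
  have e2 (f : K) : Dt2 f = (1 - t1 ^ 3 * t2)⁻¹ * (f - σ1 (σ2 (σ1 f))) := by
    simp only [hDt2, Function.comp_apply, hD2, map_mul, map_inv₀, map_sub, map_one, h12, sq1]
  have e3 (f : K) :
      Dt3 f = (1 - t1 ^ 2 * t2)⁻¹ * (f - σ1 (σ2 (σ1 (σ2 (σ1 f))))) := by
    have h : σ1 (σ2 t1) = t1 ^ 2 * t2 := by
      simp only [h21, map_mul, h11, h12]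
      field_simp
    simp only [hDt3, Function.comp_apply, hD1, map_mul, map_inv₀, map_sub, map_one, h, sq1, sq2]
  have e4 (f : K) :
      Dt4 f = (1 - t1 ^ 3 * t2 ^ 2)⁻¹ * (f - σ2 (σ1 (σ2 (σ1 (σ2 f))))) := by
    have h : σ2 (σ1 t2) = t1 ^ 3 * t2 ^ 2 := by
      simp only [h12, map_mul, map_pow, h21, h22]
      field_simp
    simp only [hDt4, Function.comp_apply, hD2, map_mul, map_inv₀, map_sub, map_one, h, sq1, sq2]
  have e5 (f : K) : Dt5 f = (1 - t1 * t2)⁻¹ * (f - σ2 (σ1 (σ2 f))) := by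
    simp only [hDt5, Function.comp_apply, hD1, map_mul, map_inv₀, map_sub, map_one, h21, sq2]
  have e6 (f : K) : Dt6 f = (1 - t2)⁻¹ * (f - σ2 f) := by
    rw [hDt6, hD2]
  intro f
  have n1 : 1 - t1 ≠ 0 := by simpa using one_sub_t1_pow_mul_t2_pow_ne_zero 1 0 (by simp)
  have n2 := one_sub_t1_pow_mul_t2_pow_ne_zero 3 1 (by simp)
  have n3 := one_sub_t1_pow_mul_t2_pow_ne_zero 2 1 (by simp)
  have n4 := one_sub_t1_pow_mul_t2_pow_ne_zero 3 2 (by simp)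
  have n5 : 1 - t1 * t2 ≠ 0 := by simpa using one_sub_t1_pow_mul_t2_pow_ne_zero 1 1 (by simp)
  have n6 : 1 - t2 ≠ 0 := by simpa using one_sub_t1_pow_mul_t2_pow_ne_zero 0 1 (by simp)
  rw [pow_one] at n2 n3
  have c1 : σ2 (1 - t1) = 1 - t1 * t2 := by simp [h21]
  have c2 : σ1 (1 - t1 ^ 3 * t2) = 1 - t2 := by
    simp only [map_sub, map_one, map_mul, map_pow, h11, h12]
    field_simp
  have c3 : σ1 (σ2 (σ1 (1 - t1 ^ 2 * t2))) = -(1 - t1) / t1 := by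
    simp only [map_sub, map_one, map_mul, map_pow, map_inv₀, h11, h12, h21, h22]
    field_simp
    ring
  have c4 : σ1 (σ2 (σ1 (σ2 (σ1 (1 - t1 ^ 3 * t2 ^ 2))))) = -(1 - t1 ^ 3 * t2) / (t1 ^ 3 * t2) := by
    simp only [map_sub, map_one, map_mul, map_pow, map_inv₀, h11, h12, h21, h22]
    field_simp
    ring
  have c5 : σ2 (σ1 (σ2 (σ1 (σ2 (1 - t1 * t2))))) = -(1 - t1 ^ 2 * t2) / (t1 ^ 2 * t2) := by
    simp only [map_sub, map_one, map_mul, map_pow, map_inv₀, h11, h12, h21, h22]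
    field_simp
    ring
  have c6 : σ2 (σ1 (σ2 (1 - t2))) = -(1 - t1 ^ 3 * t2 ^ 2) / (t1 ^ 3 * t2 ^ 2) := by
    simp only [map_sub, map_one, map_mul, map_pow, map_inv₀, h12, h21, h22]
    field_simp
    ring
  rw [e6 (Dt1 f), e1 (Dt2 f), e2 (Dt3 f), e3 (Dt4 f), e4 (Dt5 f), e5 (Dt6 f),
    e1 f, e2 f, e3 f, e4 f, e5 f, e6 f]
  simp only [map_mul σ1, map_mul σ2, map_inv₀ σ1, map_inv₀ σ2, map_sub σ1 f, map_sub σ2 f,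
    map_sub σ1 (σ2 _), map_sub σ2 (σ1 _)]
  rw [c1, c2, c3, c4, c5, c6]
  simp only [sq1, sq2, braid]
  generalize σ1 (σ2 (σ1 (σ2 (σ1 f)))) = g3
  generalize σ2 (σ1 (σ2 (σ1 (σ2 f)))) = g4
  generalize σ1 (σ2 (σ1 f)) = g2
  generalize σ2 (σ1 (σ2 f)) = g5
  generalize σ2 (σ1 f) = r
  generalize σ1 f = g1
  generalize σ2 f = g6
  generalize t1 = x at *
  generalize t2 = y at *
  generalize h2 : 1 - x ^ 3 * y = d2 at n2 ⊢
  generalize h3 : 1 - x ^ 2 * y = d3 at n3 ⊢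
  generalize h4 : 1 - x ^ 3 * y ^ 2 = d4 at n4 ⊢
  generalize h5 : 1 - x * y = d5 at n5 ⊢
  generalize h1 : 1 - x = d1 at n1 ⊢
  generalize h6 : 1 - y = d6 at n6 ⊢
  clear * - ht1 ht2 n1 n2 n3 n4 n5 n6 h1 h2 h3 h4 h5 h6
  field_simp
  subst h1 h2 h3 h4 h5 h6
  ring
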